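/- For every natural number m ≥ 2 there exists a set R of 2m + 1 rays in the plane and a ray t ∈ R such that the Voronoi region rreg(t) has at least (m − 1)² connected components; in particular, a single Voronoi region of the rotating rays Voronoi diagram of n rays can have Ω(n²) complexity. -/

import Mathlib

noncomputable section

open Real

abbrev Pt : Type := EuclideanSpace ℝ (Fin 2)

instance : Fact (Module.finrank ℝ Pt = 2) := ⟨finrank_euclideanSpace_fin⟩

noncomputable def stdOrient : Orientation ℝ Pt (Fin 2) :=
  (EuclideanSpace.basisFun (Fin 2) ℝ).toBasis.orientation

/-- A ray in the plane, given by its apex and its direction vector. -/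
structure Ray2 where
  apex : Pt
  dir : Pt

/-- The set of points of a ray. -/
def Ray2.carrier (r : Ray2) : Set Pt := {x | ∃ t : ℝ, 0 ≤ t ∧ x = r.apex + t • r.dir}

/-- The representative in `[0, 2π)` of an angle. -/
noncomputable def angleIco (θ : Real.Angle) : ℝ :=
  if 0 ≤ θ.toReal then θ.toReal else θ.toReal + 2 * π

open Classical in
/-- The counterclockwise angular distance from a point `x` to a ray `r`. -/
noncomputable def adist (x : Pt) (r : Ray2) : ℝ :=
  if x = r.apex then 0 else angleIco (stdOrient.oangle r.dir (x - r.apex))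

/-- The Voronoi region of a ray `r` in a finite set of rays `R`. -/
def rreg (R : Finset Ray2) (r : Ray2) : Set Pt :=
  {x | ∀ s ∈ R, s ≠ r → adist x r < adist x s}

/-- The rotating rays Voronoi diagram. -/
def RVD (R : Finset Ray2) : Set Pt :=
  (Set.univ \ ⋃ r ∈ R, rreg R r) ∪ ⋃ r ∈ R, r.carrier

/-- The point of the plane with the given coordinates. -/
noncomputable def pt (a b : ℝ) : Pt := (WithLp.equiv 2 (Fin 2 → ℝ)).symm ![a, b]

/-! ### Angular distance in coordinates -/

lemma stdOrient_areaForm (v w : Pt) : stdOrient.areaForm v w = v 0 * w 1 - v 1 * w 0 := by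
  rw [Orientation.areaForm_to_volumeForm,
    Orientation.volumeForm_robust stdOrient (EuclideanSpace.basisFun (Fin 2) ℝ) rfl,
    Module.Basis.det_apply, Matrix.det_fin_two]
  simp [Module.Basis.toMatrix_apply]
  ring

lemma stdOrient_kahler (v w : Pt) :
    stdOrient.kahler v w = ⟨v 0 * w 0 + v 1 * w 1, v 0 * w 1 - v 1 * w 0⟩ := by
  rw [Orientation.kahler_apply_apply, stdOrient_areaForm]
  apply Complex.ext <;> simp [PiLp.inner_apply, mul_comm]

/-- The argument of a complex number, normalised to `[0, 2π)`. -/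
def argIco (w : ℂ) : ℝ := if 0 ≤ w.im then w.arg else w.arg + 2 * π

lemma adist_of_ne {x : Pt} {r : Ray2} (h : x ≠ r.apex) :
    adist x r = argIco ⟨r.dir 0 * (x 0 - r.apex 0) + r.dir 1 * (x 1 - r.apex 1),
      r.dir 0 * (x 1 - r.apex 1) - r.dir 1 * (x 0 - r.apex 0)⟩ := by
  rw [adist, if_neg h, angleIco, Orientation.oangle, stdOrient_kahler,
    Complex.arg_coe_angle_toReal_eq_arg]
  simp only [argIco, Complex.arg_nonneg_iff, PiLp.sub_apply]

lemma argIco_of_nonneg {w : ℂ} (h : 0 ≤ w.im) : argIco w = w.arg := if_pos h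

lemma argIco_nonneg (w : ℂ) : 0 ≤ argIco w := by
  unfold argIco
  split_ifs with h
  · exact Complex.arg_nonneg_iff.2 h
  · linarith [Complex.neg_pi_lt_arg w, Real.pi_pos]

lemma pi_lt_argIco {w : ℂ} (h : w.im < 0) : π < argIco w := by
  rw [argIco, if_neg (not_le.2 h)]
  linarith [Complex.neg_pi_lt_arg w]

lemma argIco_eq_zero_iff {w : ℂ} : argIco w = 0 ↔ 0 ≤ w.re ∧ w.im = 0 := by
  rw [← Complex.arg_eq_zero_iff]
  rcases le_or_gt 0 w.im with h | h
  · rw [argIco_of_nonneg h]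
  · have h1 := pi_lt_argIco h
    have h2 := Complex.arg_neg_iff.2 h
    constructor <;> intro h3 <;> linarith [Real.pi_pos]

lemma argIco_le_arg_iff {w z : ℂ} (hw : w ≠ 0) (hz : 0 < z.im) :
    argIco w ≤ z.arg ↔ 0 ≤ w.im ∧ 0 ≤ w.re * z.im - w.im * z.re := by
  have hzπ : z.arg < π := Complex.arg_lt_pi_iff.2 (Or.inr hz.ne')
  have hz0 : 0 < z.arg :=
    lt_of_le_of_ne (Complex.arg_nonneg_iff.2 hz.le) fun h =>
      hz.ne' (Complex.arg_eq_zero_iff.1 h.symm).2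
  rcases lt_or_ge w.im 0 with h | h
  · exact iff_of_false (by linarith [pi_lt_argIco h]) fun h' => by linarith [h'.1]
  · rw [argIco_of_nonneg h]
    have hw0 : 0 ≤ w.arg := Complex.arg_nonneg_iff.2 h
    have hwπ : w.arg ≤ π := Complex.arg_le_pi w
    have hwn : 0 < ‖w‖ := norm_pos_iff.2 hw
    have hzn : 0 < ‖z‖ := norm_pos_iff.2 fun h' => by simp [h'] at hz
    have key : w.re * z.im - w.im * z.re = ‖w‖ * ‖z‖ * Real.sin (z.arg - w.arg) := by
      rw [Real.sin_sub]
      linear_combination -(‖z‖ * Real.sin z.arg) * Complex.norm_mul_cos_arg w -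
        w.re * Complex.norm_mul_sin_arg z + (‖z‖ * Real.cos z.arg) * Complex.norm_mul_sin_arg w +
        w.im * Complex.norm_mul_cos_arg z
    rw [key]
    constructor
    · intro h'
      exact ⟨h, mul_nonneg (by positivity)
        (Real.sin_nonneg_of_nonneg_of_le_pi (by linarith) (by linarith))⟩
    · rintro ⟨-, h'⟩
      by_contra! hlt
      have := Real.sin_neg_of_neg_of_neg_pi_lt (x := z.arg - w.arg) (by linarith) (by linarith)
      nlinarith [mul_pos hwn hzn]

/-! ### The rays of the construction -/

/-- The ray along the positive first coordinate axis. -/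
def axisRay : Ray2 := ⟨pt 0 0, pt 1 0⟩

/-- The ray along the negative first coordinate axis. -/
def negAxisRay : Ray2 := ⟨pt 0 0, pt (-1) 0⟩

/-- The ray with apex `(a, 0)` and direction `(κ, 1)`, where `q = (κ, a)`. -/
def slantRay (q : ℝ × ℝ) : Ray2 := ⟨pt q.2 0, pt q.1 1⟩

/-- The upper half plane with the positive first coordinate axis. -/
def upperSector : Set Pt := {x | 0 < x 1 ∨ x 1 = 0 ∧ 0 < x 0}

/-- The open half plane to the right of `slantRay q`. -/
def rightSide (q : ℝ × ℝ) : Set Pt := {x | q.2 < x 0 - q.1 * x 1}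

/-- The open disc bounded by the bisecting circle of `axisRay` and `slantRay q`. -/
def bisectorDisc (q : ℝ × ℝ) : Set Pt := {x | x 0 ^ 2 + x 1 ^ 2 < q.2 * (x 0 + q.1 * x 1)}

@[simp] lemma pt_zero (a b : ℝ) : pt a b 0 = a := by simp [pt]

@[simp] lemma pt_one (a b : ℝ) : pt a b 1 = b := by simp [pt]

lemma eq_pt_iff {x : Pt} {a b : ℝ} : x = pt a b ↔ x 0 = a ∧ x 1 = b := by
  constructor
  · rintro rfl
    simp
  · rintro ⟨h0, h1⟩
    ext i
    fin_cases i <;> simp [h0, h1]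

lemma adist_axisRay {x : Pt} (hx : x ≠ pt 0 0) : adist x axisRay = argIco ⟨x 0, x 1⟩ := by
  rw [adist_of_ne (r := axisRay) hx]
  simp [axisRay]

lemma adist_negAxisRay {x : Pt} (hx : x ≠ pt 0 0) :
    adist x negAxisRay = argIco ⟨-x 0, -x 1⟩ := by
  rw [adist_of_ne (r := negAxisRay) hx]
  simp [negAxisRay]

lemma ne_of_mem_upperSector {x : Pt} (hx : x ∈ upperSector) : x ≠ pt 0 0 := by
  rw [Ne, eq_pt_iff]
  rintro ⟨h0, h1⟩
  rcases hx with h | ⟨-, h⟩ <;> linarith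

lemma adist_axisRay_lt_negAxisRay_iff (x : Pt) :
    adist x axisRay < adist x negAxisRay ↔ x ∈ upperSector := by
  by_cases hx : x = pt 0 0
  · refine iff_of_false ?_ fun h => ne_of_mem_upperSector h hx
    simp [adist, axisRay, negAxisRay, hx]
  rw [adist_axisRay hx, adist_negAxisRay hx]
  simp only [upperSector, Set.mem_ofPred_eq]
  rcases lt_trichotomy (x 1) 0 with h | h | h
  · refine iff_of_false ?_ (by rintro (h' | ⟨h', -⟩) <;> linarith)
    have h1 := pi_lt_argIco (w := ⟨x 0, x 1⟩) h
    rw [argIco_of_nonneg (w := ⟨-x 0, -x 1⟩) (by simpa using h.le)]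
    linarith [Complex.arg_le_pi ⟨-x 0, -x 1⟩]
  · rcases lt_trichotomy (x 0) 0 with h0 | h0 | h0
    · refine iff_of_false ?_ (by rintro (h' | ⟨-, h'⟩) <;> linarith)
      rw [argIco_eq_zero_iff (w := ⟨-x 0, -x 1⟩).2 ⟨by simpa using h0.le, by simp [h]⟩]
      exact not_lt.2 (argIco_nonneg _)
    · exact absurd (eq_pt_iff.2 ⟨h0, h⟩) hx
    · refine iff_of_true ?_ (Or.inr ⟨h, h0⟩)
      rw [argIco_eq_zero_iff.2 ⟨h0.le, h⟩]
      refine lt_of_le_of_ne (argIco_nonneg _) fun h' => ?_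
      have := (argIco_eq_zero_iff.1 h'.symm).1
      simp only at this
      linarith
  · refine iff_of_true ?_ (Or.inl h)
    rw [argIco_of_nonneg (w := ⟨x 0, x 1⟩) h.le]
    exact (Complex.arg_le_pi _).trans_lt (pi_lt_argIco (by simpa using h))

lemma adist_axisRay_lt_slantRay_iff {x : Pt} (hx : x ∈ upperSector) (q : ℝ × ℝ) :
    adist x axisRay < adist x (slantRay q) ↔ x ∈ rightSide q ∪ bisectorDisc q := by
  obtain ⟨κ, a⟩ := q
  simp only [rightSide, bisectorDisc, Set.mem_union, Set.mem_ofPred_eq]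
  rw [adist_axisRay (ne_of_mem_upperSector hx)]
  by_cases hp : x = pt a 0
  · rw [show adist x (slantRay (κ, a)) = 0 from if_pos hp]
    refine iff_of_false (not_lt.2 (argIco_nonneg _)) ?_
    obtain ⟨h0, h1⟩ := eq_pt_iff.1 hp
    rw [h0, h1]
    rintro (h | h) <;> nlinarith
  rw [adist_of_ne (r := slantRay (κ, a)) hp]
  simp only [slantRay, pt_zero, pt_one, sub_zero, one_mul]
  rcases hx with h | ⟨h, h0⟩
  · rw [argIco_of_nonneg (w := ⟨x 0, x 1⟩) h.le, ← not_le, argIco_le_arg_iff _ h]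
    · simp only [not_and_or, not_le]
      refine or_congr ?_ ?_ <;> constructor <;> intro h' <;> linarith
    · intro h'
      have hre := congrArg Complex.re h'
      have him := congrArg Complex.im h'
      simp only [Complex.zero_re, Complex.zero_im] at hre him
      nlinarith [mul_pos h h, sq_nonneg (x 0 - a), sq_nonneg κ]
  · rw [argIco_eq_zero_iff.2 ⟨h0.le, h⟩]
    have hne : x 0 ≠ a := fun h' => hp (eq_pt_iff.2 ⟨h', h⟩)
    refine iff_of_true (lt_of_le_of_ne (argIco_nonneg _) fun h' => ?_) ?_
    · have := (argIco_eq_zero_iff.1 h'.symm).2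
      simp only [h] at this
      exact hne (by linarith)
    · rcases lt_or_gt_of_ne hne with h' | h'
      · right
        rw [h]
        nlinarith
      · left
        rw [h]
        linarith

lemma disjoint_rightSide_bisectorDisc {q : ℝ × ℝ} (hq : 0 < q.2) :
    Disjoint (rightSide q) (bisectorDisc q) := by
  rw [Set.disjoint_left]
  intro x h h'
  simp only [rightSide, bisectorDisc, Set.mem_ofPred_eq] at h h'
  have hpos : 0 < x 0 + q.1 * x 1 := by
    by_contra! hn
    nlinarith [sq_nonneg (x 0), sq_nonneg (x 1)]
  nlinarith [mul_lt_mul_of_pos_right h hpos, sq_nonneg (x 1), sq_nonneg (q.1 * x 1)]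

lemma convex_upperSector : Convex ℝ upperSector := by
  intro x hx y hy a b ha hb hab
  simp only [upperSector, Set.mem_ofPred_eq, PiLp.add_apply, PiLp.smul_apply,
    smul_eq_mul] at hx hy ⊢
  rcases ha.eq_or_lt with rfl | ha
  · obtain rfl : b = 1 := by linarith
    simpa using hy
  rcases hb.eq_or_lt with rfl | hb
  · obtain rfl : a = 1 := by linarith
    simpa using hx
  rcases hx with hx | ⟨hx, hx0⟩ <;> rcases hy with hy | ⟨hy, hy0⟩
  · left; positivity
  · left; rw [hy]; simpa using mul_pos ha hx
  · left; rw [hx]; simpa using mul_pos hb hy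
  · right; rw [hx, hy]; exact ⟨by simp, by positivity⟩

lemma convex_rightSide (q : ℝ × ℝ) : Convex ℝ (rightSide q) := by
  intro x hx y hy a b ha hb hab
  simp only [rightSide, Set.mem_ofPred_eq, PiLp.add_apply, PiLp.smul_apply,
    smul_eq_mul] at hx hy ⊢
  obtain rfl : b = 1 - a := by linarith
  rcases ha.eq_or_lt with rfl | ha
  · linarith
  · nlinarith [mul_lt_mul_of_pos_left hx ha, mul_le_mul_of_nonneg_left hy.le hb]

lemma convex_bisectorDisc (q : ℝ × ℝ) : Convex ℝ (bisectorDisc q) := by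
  intro x hx y hy a b ha hb hab
  simp only [bisectorDisc, Set.mem_ofPred_eq, PiLp.add_apply, PiLp.smul_apply,
    smul_eq_mul] at hx hy ⊢
  obtain rfl : b = 1 - a := by linarith
  rcases ha.eq_or_lt with rfl | ha
  · linarith
  · have h0 := mul_nonneg (mul_nonneg ha.le hb) (sq_nonneg (x 0 - y 0))
    have h1 := mul_nonneg (mul_nonneg ha.le hb) (sq_nonneg (x 1 - y 1))
    nlinarith [mul_lt_mul_of_pos_left hx ha, mul_le_mul_of_nonneg_left hy.le hb]

lemma isOpen_rightSide (q : ℝ × ℝ) : IsOpen (rightSide q) :=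
  isOpen_lt (by fun_prop) (by fun_prop)

lemma isOpen_bisectorDisc (q : ℝ × ℝ) : IsOpen (bisectorDisc q) :=
  isOpen_lt (by fun_prop) (by fun_prop)

/-! ### Components of the region of the axis ray -/

open Classical in
/-- The two axis rays together with the slanted rays given by `P`. -/
def raySet (P : Finset (ℝ × ℝ)) : Finset Ray2 :=
  insert axisRay (insert negAxisRay (P.image slantRay))

lemma slantRay_injective : Function.Injective slantRay := by
  intro q q' h
  have h1 := congrArg (fun r : Ray2 => r.dir 0) h
  have h2 := congrArg (fun r : Ray2 => r.apex 0) h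
  simp only [slantRay, pt_zero] at h1 h2
  exact Prod.ext h1 h2

lemma slantRay_ne_axisRay (q : ℝ × ℝ) : slantRay q ≠ axisRay := fun h => by
  simpa [slantRay, axisRay] using congrArg (fun r : Ray2 => r.dir 1) h

lemma slantRay_ne_negAxisRay (q : ℝ × ℝ) : slantRay q ≠ negAxisRay := fun h => by
  simpa [slantRay, negAxisRay] using congrArg (fun r : Ray2 => r.dir 1) h

lemma negAxisRay_ne_axisRay : negAxisRay ≠ axisRay := fun h => by
  have := congrArg (fun r : Ray2 => r.dir 0) h
  simp only [negAxisRay, axisRay, pt_zero] at this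
  norm_num at this

open Classical in
lemma card_raySet (P : Finset (ℝ × ℝ)) : (raySet P).card = P.card + 2 := by
  rw [raySet, Finset.card_insert_of_notMem, Finset.card_insert_of_notMem,
    Finset.card_image_of_injective _ slantRay_injective]
  · simp [slantRay_ne_negAxisRay]
  · simp [slantRay_ne_axisRay, negAxisRay_ne_axisRay.symm]

lemma dir_ne_zero_of_mem_raySet {P : Finset (ℝ × ℝ)} {r : Ray2} (hr : r ∈ raySet P) :
    r.dir ≠ 0 := by
  simp only [raySet, Finset.mem_insert, Finset.mem_image] at hr
  rcases hr with rfl | rfl | ⟨q, -, rfl⟩ <;> intro h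
  · simpa [axisRay] using congrArg (fun v : Pt => v 0) h
  · simpa [negAxisRay] using congrArg (fun v : Pt => v 0) h
  · simpa [slantRay] using congrArg (fun v : Pt => v 1) h

lemma mem_rreg_raySet_iff {P : Finset (ℝ × ℝ)} {x : Pt} :
    x ∈ rreg (raySet P) axisRay ↔
      x ∈ upperSector ∧ ∀ q ∈ P, x ∈ rightSide q ∪ bisectorDisc q := by
  simp only [rreg, raySet, Finset.mem_insert, Finset.mem_image, Set.mem_ofPred_eq]
  constructor
  · intro h
    have hx := (adist_axisRay_lt_negAxisRay_iff x).1
      (h _ (Or.inr (Or.inl rfl)) negAxisRay_ne_axisRay)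
    exact ⟨hx, fun q hq => (adist_axisRay_lt_slantRay_iff hx q).1
      (h _ (Or.inr (Or.inr ⟨q, hq, rfl⟩)) (slantRay_ne_axisRay q))⟩
  · rintro ⟨hx, h⟩ s (rfl | rfl | ⟨q, hq, rfl⟩) hs
    · exact absurd rfl hs
    · exact (adist_axisRay_lt_negAxisRay_iff x).2 hx
    · exact (adist_axisRay_lt_slantRay_iff hx q).2 (h q hq)

lemma connectedComponents_mk_eq_of_isPreconnected {α : Type*} [TopologicalSpace α] {X C : Set α}
    (hC : IsPreconnected C) (hCX : C ⊆ X) {x y : X} (hx : (x : α) ∈ C) (hy : (y : α) ∈ C) :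
    (x : ConnectedComponents X) = y := by
  have hpre : IsPreconnected ((↑) ⁻¹' C : Set X) := by
    rw [← Topology.IsInducing.subtypeVal.isPreconnected_image,
      Subtype.image_preimage_coe, Set.inter_eq_right.2 hCX]
    exact hC
  exact ConnectedComponents.coe_eq_coe'.2 (hpre.subset_connectedComponent hy hx)

open Classical in
lemma finite_connectedComponents_rreg (P : Finset (ℝ × ℝ)) :
    Finite (ConnectedComponents (rreg (raySet P) axisRay)) := by
  let side (c : ConnectedComponents (rreg (raySet P) axisRay)) : Set P :=
    {q | (c.exists_rep.choose : Pt) ∈ rightSide q}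
  refine Finite.of_injective side fun c d hcd => ?_
  have hc := c.exists_rep.choose_spec
  have hd := d.exists_rep.choose_spec
  simp only [side, Set.ext_iff, Set.mem_ofPred_eq] at hcd
  generalize c.exists_rep.choose = x at hc hcd
  generalize d.exists_rep.choose = y at hd hcd
  rw [← hc, ← hd]
  have hconv : Convex ℝ (upperSector ∩ ⋂ q : P,
      if (x : Pt) ∈ rightSide q then rightSide q else bisectorDisc q) := by
    refine convex_upperSector.inter (convex_iInter fun q => ?_)
    split_ifs
    exacts [convex_rightSide _, convex_bisectorDisc _]
  have hx := mem_rreg_raySet_iff.1 x.2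
  have hy := mem_rreg_raySet_iff.1 y.2
  refine connectedComponents_mk_eq_of_isPreconnected hconv.isPreconnected ?_
    ⟨hx.1, Set.mem_iInter.2 fun q => ?_⟩ ⟨hy.1, Set.mem_iInter.2 fun q => ?_⟩
  · rintro z ⟨hz, hz'⟩
    refine mem_rreg_raySet_iff.2 ⟨hz, fun q hq => ?_⟩
    have := Set.mem_iInter.1 hz' ⟨q, hq⟩
    split_ifs at this
    exacts [Or.inl this, Or.inr this]
  · split_ifs with h
    exacts [h, (hx.2 q q.2).resolve_left h]
  · split_ifs with h
    exacts [(hcd q).1 h, (hy.2 q q.2).resolve_left fun h' => h ((hcd q).2 h')]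

lemma mem_rightSide_of_connectedComponents_mk_eq {P : Finset (ℝ × ℝ)} {q : ℝ × ℝ} (hq : q ∈ P)
    (hpos : 0 < q.2) {x y : rreg (raySet P) axisRay}
    (h : (x : ConnectedComponents (rreg (raySet P) axisRay)) = y)
    (hy : (y : Pt) ∈ rightSide q) : (x : Pt) ∈ rightSide q := by
  have hclopen : IsClopen ((↑) ⁻¹' rightSide q : Set (rreg (raySet P) axisRay)) := by
    refine ⟨⟨?_⟩, (isOpen_rightSide q).preimage continuous_subtype_val⟩
    convert (isOpen_bisectorDisc q).preimage continuous_subtype_val using 1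
    ext z
    refine ⟨((mem_rreg_raySet_iff.1 z.2).2 q hq).resolve_left, fun h1 h2 => ?_⟩
    exact Set.disjoint_left.1 (disjoint_rightSide_bisectorDisc hpos) h2 h1
  have hxy := ConnectedComponents.coe_eq_coe'.1 h
  exact hclopen.connectedComponent_subset hy hxy

/-! ### The grid -/

/-- Parameters of `m` rays of direction `(1, 1)` and `m - 1` rays of direction `(-1, 1)`. -/
def gridParams (m : ℕ) : Finset (ℝ × ℝ) :=
  (Finset.range m).image (fun i : ℕ => ((1 : ℝ), 16 * (m : ℝ) ^ 2 + 2 * i)) ∪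
    (Finset.range (m - 1)).image (fun j : ℕ => ((-1 : ℝ), 16 * (m : ℝ) ^ 2 + 2 * m + 2 * j))

lemma card_gridParams (m : ℕ) : (gridParams m).card = m + (m - 1) := by
  rw [gridParams, Finset.card_union_of_disjoint, Finset.card_image_of_injective,
    Finset.card_image_of_injective, Finset.card_range, Finset.card_range]
  · intro i j h
    simpa using h
  · intro i j h
    simpa using h
  · rw [Finset.disjoint_left]
    intro q h h'
    simp only [Finset.mem_image] at h h'
    obtain ⟨i, -, rfl⟩ := h
    obtain ⟨j, -, h'⟩ := h'
    have := congrArg Prod.fst h'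
    norm_num at this

/-- A point of the grid cell with indices `i` and `j`. -/
def gridPoint (m i j : ℕ) : Pt := pt (16 * m ^ 2 + m + i + j + 1) (m + j - i)

lemma gridPoint_mem_rightSide_pos {m i j k : ℕ} :
    gridPoint m i j ∈ rightSide (1, 16 * (m : ℝ) ^ 2 + 2 * k) ↔ k ≤ i := by
  simp only [rightSide, gridPoint, Set.mem_ofPred_eq, pt_zero, pt_one]
  constructor <;> intro h
  · by_contra! hlt
    have : (i : ℝ) + 1 ≤ k := by exact_mod_cast hlt
    linarith
  · have : (k : ℝ) ≤ i := by exact_mod_cast h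
    linarith

lemma gridPoint_mem_rightSide_neg {m i j k : ℕ} :
    gridPoint m i j ∈ rightSide (-1, 16 * (m : ℝ) ^ 2 + 2 * m + 2 * k) ↔ k ≤ j := by
  simp only [rightSide, gridPoint, Set.mem_ofPred_eq, pt_zero, pt_one]
  constructor <;> intro h
  · by_contra! hlt
    have : (j : ℝ) + 1 ≤ k := by exact_mod_cast hlt
    linarith
  · have : (k : ℝ) ≤ j := by exact_mod_cast h
    linarith

lemma gridPoint_mem_rreg {m i j : ℕ} (hi : i < m) (hj : j < m) :
    gridPoint m i j ∈ rreg (raySet (gridParams m)) axisRay := by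
  have hi' : (i : ℝ) + 1 ≤ m := by exact_mod_cast hi
  have hj' : (j : ℝ) + 1 ≤ m := by exact_mod_cast hj
  have hi0 : (0 : ℝ) ≤ i := by positivity
  have hj0 : (0 : ℝ) ≤ j := by positivity
  have hy0 : (0 : ℝ) < m + j - i := by linarith
  have hsq : ((m : ℝ) + j - i) ^ 2 ≤ (2 * m) ^ 2 := by gcongr; linarith
  refine mem_rreg_raySet_iff.2 ⟨Or.inl (by simpa [gridPoint] using hy0), fun q hq => ?_⟩
  simp only [gridParams, Finset.mem_union, Finset.mem_image] at hq
  rcases hq with ⟨k, -, rfl⟩ | ⟨k, -, rfl⟩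
  · rcases le_or_gt k i with h | h
    · exact Or.inl (gridPoint_mem_rightSide_pos.2 h)
    · right
      have h' : (i : ℝ) + 1 ≤ k := by exact_mod_cast h
      simp only [bisectorDisc, gridPoint, Set.mem_ofPred_eq, pt_zero, pt_one]
      have : (16 * (m : ℝ) ^ 2 + 2 * (i + 1)) * (16 * m ^ 2 + 2 * m + 2 * j + 1) ≤
        (16 * (m : ℝ) ^ 2 + 2 * k) * (16 * m ^ 2 + 2 * m + 2 * j + 1) := by gcongr
      nlinarith
  · rcases le_or_gt k j with h | h
    · exact Or.inl (gridPoint_mem_rightSide_neg.2 h)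
    · right
      have h' : (j : ℝ) + 1 ≤ k := by exact_mod_cast h
      simp only [bisectorDisc, gridPoint, Set.mem_ofPred_eq, pt_zero, pt_one]
      have : (16 * (m : ℝ) ^ 2 + 2 * m + 2 * (j + 1)) * (16 * m ^ 2 + 2 * i + 1) ≤
        (16 * (m : ℝ) ^ 2 + 2 * m + 2 * k) * (16 * m ^ 2 + 2 * i + 1) := by gcongr
      nlinarith

/-- for every `m ≥ 2` there is a set of `2 m + 1` rays, one of whose Voronoi
regions has at least `(m - 1)²` connected components. -/
theorem stmt4 (m : ℕ) (hm : 2 ≤ m) :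
    ∃ R : Finset Ray2, R.card = 2 * m + 1 ∧ (∀ r ∈ R, r.dir ≠ 0) ∧
      ∃ t ∈ R, (m - 1) ^ 2 ≤ Nat.card (ConnectedComponents ↥(rreg R t)) := by
  refine ⟨raySet (gridParams m), ?_, fun r => dir_ne_zero_of_mem_raySet, axisRay,
    by simp [raySet], ?_⟩
  · rw [card_raySet, card_gridParams]
    omega
  have hfin := finite_connectedComponents_rreg (gridParams m)
  have hmem (p : Fin (m - 1) × Fin (m - 1)) :
      gridPoint m p.1 p.2 ∈ rreg (raySet (gridParams m)) axisRay :=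
    gridPoint_mem_rreg (by omega) (by omega)
  have hm0 : (0 : ℝ) < m := by positivity
  have hle (p p' : Fin (m - 1) × Fin (m - 1))
      (h : ((⟨_, hmem p⟩ : rreg (raySet (gridParams m)) axisRay) :
        ConnectedComponents (rreg (raySet (gridParams m)) axisRay)) =
          (⟨_, hmem p'⟩ : rreg (raySet (gridParams m)) axisRay)) : p' ≤ p := by
    constructor
    · refine gridPoint_mem_rightSide_pos.1 (mem_rightSide_of_connectedComponents_mk_eq
        (Finset.mem_union_left _ (Finset.mem_image_of_mem _ (Finset.mem_range.2 ?_)))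
        ?_ h (gridPoint_mem_rightSide_pos.2 le_rfl))
      · omega
      · positivity
    · refine gridPoint_mem_rightSide_neg.1 (mem_rightSide_of_connectedComponents_mk_eq
        (Finset.mem_union_right _ (Finset.mem_image_of_mem _ (Finset.mem_range.2 ?_)))
        ?_ h (gridPoint_mem_rightSide_neg.2 le_rfl))
      · omega
      · positivity
  have hcard := Nat.card_le_card_of_injective
    (fun p => ((⟨_, hmem p⟩ : rreg (raySet (gridParams m)) axisRay) :
        ConnectedComponents (rreg (raySet (gridParams m)) axisRay)))
    fun p p' h => le_antisymm (hle p' p h.symm) (hle p p' h)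
  simpa [sq] using hcard
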